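/- arXiv:0708.3399 — 5 statements merged into one kernel-verified Lean document; each statement's English description precedes it below -/
import Mathlib

section
/- Let a : ℕ → ℝ satisfy a(1) = 2, a(2) = 4, and a(d) = 2·a(d-1) + a(d-2) for all d ≥ 3. Then for every d ≥ 1, (1+√2)^(d-1) ≤ a(d) ≤ (1+√2)^d. -/
theorem minimum_bridge_number_two_sided_bound (a : ℕ → ℝ)
    (h1 : a 1 = 2) (h2 : a 2 = 4)
    (hrec : ∀ d : ℕ, 3 ≤ d → a d = 2 * a (d - 1) + a (d - 2)) :
    ∀ d : ℕ, 1 ≤ d →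
      (1 + Real.sqrt 2) ^ (d - 1) ≤ a d ∧ a d ≤ (1 + Real.sqrt 2) ^ d := by
  have hs : Real.sqrt 2 ^ 2 = 2 := Real.sq_sqrt zero_le_two
  have hs_nonneg : 0 ≤ Real.sqrt 2 := Real.sqrt_nonneg 2
  have hstep : ∀ n : ℕ, (1 + Real.sqrt 2) ^ (n + 2)
      = 2 * (1 + Real.sqrt 2) ^ (n + 1) + (1 + Real.sqrt 2) ^ n := by
    intro n
    linear_combination (1 + Real.sqrt 2) ^ n * hs
  suffices h : ∀ n : ℕ,
      (1 + Real.sqrt 2) ^ n ≤ a (n + 1) ∧ a (n + 1) ≤ (1 + Real.sqrt 2) ^ (n + 1) by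
    intro d hd
    obtain ⟨n, rfl⟩ := Nat.exists_eq_add_of_le' hd
    exact h n
  intro n
  induction n using Nat.twoStepInduction with
  | zero => constructor <;> simp only [zero_add, pow_zero, pow_one, h1] <;> nlinarith
  | one => constructor <;> simp only [Nat.reduceAdd, pow_one, h2] <;> nlinarith
  | more n ih ih' =>
    have hr : a (n + 3) = 2 * a (n + 2) + a (n + 1) := hrec (n + 3) (by lia)
    have hlow := hstep n
    have hupp := hstep (n + 1)
    constructor
    · linarith [ih.1, ih'.1]
    · linarith [ih.2, ih'.2]
end

section
/- Let b : ℕ → ℕ satisfy b(2) = 2, b(3) = 2, and the recursion b(2n) = b(2n-1) + b(2n-2) and b(2n+1) = b(2n) + b(2n-2) for all n ≥ 2. Let a : ℕ → ℕ satisfy a(1) = 2, a(2) = 4, and a(d) = 2·a(d-1) + a(d-2) for all d ≥ 3. Then b(2d) = a(d) for every d ≥ 1. -/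
theorem cheapest_descent_equals_minimum_bridge_sequence (b a : ℕ → ℕ)
    (hb2 : b 2 = 2) (hb3 : b 3 = 2)
    (hbrec : ∀ n : ℕ, 2 ≤ n →
      b (2 * n) = b (2 * n - 1) + b (2 * n - 2) ∧
      b (2 * n + 1) = b (2 * n) + b (2 * n - 2))
    (ha1 : a 1 = 2) (ha2 : a 2 = 4)
    (harec : ∀ d : ℕ, 3 ≤ d → a d = 2 * a (d - 1) + a (d - 2)) :
    ∀ d : ℕ, 1 ≤ d → b (2 * d) = a d := by
  intro d hd
  induction d using Nat.strong_induction_on with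
  | _ d ih =>
    match d, hd, ih with
    | 1, _, _ => rw [ha1]; exact hb2
    | 2, _, _ =>
      have h : b 4 = b 3 + b 2 := (hbrec 2 le_rfl).1
      rw [ha2]
      change b 4 = 4
      rw [h, hb2, hb3]
    | k + 3, _, ih =>
      have h_even : b (2 * (k + 3)) = b (2 * (k + 2) + 1) + b (2 * (k + 2)) :=
        (hbrec (k + 3) (by omega)).1
      have h_odd : b (2 * (k + 2) + 1) = b (2 * (k + 2)) + b (2 * (k + 1)) :=
        (hbrec (k + 2) (by omega)).2
      have h_rec : a (k + 3) = 2 * a (k + 2) + a (k + 1) := harec (k + 3) (by omega)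
      have ih_one := ih (k + 1) (by omega) (by omega)
      have ih_two := ih (k + 2) (by omega) (by omega)
      omega
end

section
/- Let b : ℕ → ℕ satisfy b(2) = 2, b(3) = 3, and the recursion b(2n) = b(2n-1) + b(2n-2) and b(2n+1) = b(2n) + b(2n-2) for all n ≥ 2. Let a' : ℕ → ℕ satisfy a'(1) = 2, a'(2) = 5, and a'(d) = 2·a'(d-1) + a'(d-2) for all d ≥ 3. Then b(2d) = a'(d) for every d ≥ 1. -/
theorem torus_knot_cheapest_descent_equals_torus_minimum_bridge (b a' : ℕ → ℕ)
    (hb2 : b 2 = 2) (hb3 : b 3 = 3)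
    (hbrec : ∀ n : ℕ, 2 ≤ n →
      b (2 * n) = b (2 * n - 1) + b (2 * n - 2) ∧
      b (2 * n + 1) = b (2 * n) + b (2 * n - 2))
    (ha1 : a' 1 = 2) (ha2 : a' 2 = 5)
    (harec : ∀ d : ℕ, 3 ≤ d → a' d = 2 * a' (d - 1) + a' (d - 2)) :
    ∀ d : ℕ, 1 ≤ d → b (2 * d) = a' d := by
  have b_even_rec (n : ℕ) : b (2 * (n + 3)) = 2 * b (2 * (n + 2)) + b (2 * (n + 1)) := by
    have h_even := (hbrec (n + 3) (by omega)).1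
    have h_odd := (hbrec (n + 2) (by omega)).2
    rw [show 2 * (n + 3) - 1 = 2 * (n + 2) + 1 by omega,
      show 2 * (n + 3) - 2 = 2 * (n + 2) by omega] at h_even
    rw [show 2 * (n + 2) - 2 = 2 * (n + 1) by omega] at h_odd
    omega
  have consecutive (n : ℕ) :
      b (2 * (n + 1)) = a' (n + 1) ∧ b (2 * (n + 2)) = a' (n + 2) := by
    induction n with
    | zero =>
      have h_four : b 4 = b 3 + b 2 := (hbrec 2 le_rfl).1
      exact ⟨hb2.trans ha1.symm, by simp [h_four, hb2, hb3, ha2]⟩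
    | succ n ih =>
      refine ⟨ih.2, ?_⟩
      have ha : a' (n + 3) = 2 * a' (n + 2) + a' (n + 1) := harec (n + 3) (by omega)
      have hb := b_even_rec n
      rw [ih.1, ih.2, ← ha] at hb
      exact hb
  intro d hd
  obtain ⟨n, rfl⟩ := Nat.exists_eq_add_of_le' hd
  exact (consecutive n).1
end

section
/- Let b : ℕ → ℕ satisfy b(2) ≥ 2, b(3) ≥ 2, and the recursion b(2n) = b(2n-1) + b(2n-2) and b(2n+1) = b(2n) + b(2n-2) for all n ≥ 2. Let a : ℕ → ℕ satisfy a(1) = 2, a(2) = 4, and a(d) = 2·a(d-1) + a(d-2) for all d ≥ 3. Then b(2d) ≥ a(d) for every d ≥ 1. -/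
theorem cheapest_descent_lower_bound (b a : ℕ → ℕ)
    (hb2 : 2 ≤ b 2) (hb3 : 2 ≤ b 3)
    (hbrec : ∀ n : ℕ, 2 ≤ n →
      b (2 * n) = b (2 * n - 1) + b (2 * n - 2) ∧
      b (2 * n + 1) = b (2 * n) + b (2 * n - 2))
    (ha1 : a 1 = 2) (ha2 : a 2 = 4)
    (harec : ∀ d : ℕ, 3 ≤ d → a d = 2 * a (d - 1) + a (d - 2)) :
    ∀ d : ℕ, 1 ≤ d → a d ≤ b (2 * d) := by
  have key : ∀ k : ℕ, a (k + 1) ≤ b (2 * k + 2) ∧ a (k + 2) ≤ b (2 * k + 4) := by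
    intro k
    induction k with
    | zero =>
      have h4 : b 4 = b 3 + b 2 := (hbrec 2 le_rfl).1
      simp only [mul_zero, zero_add, ha1, ha2]
      omega
    | succ k ih =>
      obtain ⟨ih₁, ih₂⟩ := ih
      have h_odd : b (2 * k + 5) = b (2 * k + 4) + b (2 * k + 2) :=
        (hbrec (k + 2) (by omega)).2
      have h_even : b (2 * k + 6) = b (2 * k + 5) + b (2 * k + 4) :=
        (hbrec (k + 3) (by omega)).1
      have h_a : a (k + 3) = 2 * a (k + 2) + a (k + 1) := harec (k + 3) (by omega)
      refine ⟨ih₂, ?_⟩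
      change a (k + 3) ≤ b (2 * k + 6)
      omega
  intro d hd
  obtain ⟨k, rfl⟩ := Nat.exists_eq_add_of_le' hd
  exact (key k).1
end

section
/- Let L₁ = [[1,0],[1,1]], R₁ = [[1,1],[0,1]], L₂ = [[0,0],[1,1]], and R₂ = [[1,1],[0,0]] in the 2×2 natural number matrices, and let S = {L₁, R₁, L₂, R₂}. Suppose a finite list of matrices, each belonging to S, contains the four consecutive entries R₁, L₁, R₁, L₁ (in that order). Then both entries of the row vector obtained by multiplying (1,1) on the right by the product of the list (in list order) are at least 2. -/
theorem Matrix.le_vecMul_of_forall_exists_one_le {m n : Type*} [Fintype m] {c : ℕ} {v : m → ℕ}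
    {M : Matrix m n ℕ} (hv : ∀ i, c ≤ v i) (hM : ∀ j, ∃ i, 1 ≤ M i j) (j : n) :
    c ≤ Matrix.vecMul v M j := by
  obtain ⟨i, hi⟩ := hM j
  calc c ≤ v i * M i j := (hv i).trans (Nat.le_mul_of_pos_right _ hi)
    _ ≤ Matrix.vecMul v M j :=
      Finset.single_le_sum (f := fun i => v i * M i j) (fun _ _ => Nat.zero_le _)
        (Finset.mem_univ i)

theorem Matrix.le_vecMul_list_prod {n : Type*} [Fintype n] [DecidableEq n] {c : ℕ}
    {l : List (Matrix n n ℕ)} (hl : ∀ M ∈ l, ∀ j, ∃ i, 1 ≤ M i j) {v : n → ℕ}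
    (hv : ∀ i, c ≤ v i) : ∀ j, c ≤ Matrix.vecMul v l.prod j := by
  induction l generalizing v with
  | nil => simpa using hv
  | cons M l ih =>
    rw [List.forall_mem_cons] at hl
    rw [List.prod_cons, ← Matrix.vecMul_vecMul]
    exact ih hl.2 (Matrix.le_vecMul_of_forall_exists_one_le hv hl.1)


theorem giant_step_count_block_R1L1R1L1 (L₁ R₁ L₂ R₂ : Matrix (Fin 2) (Fin 2) ℕ)
    (hL₁ : L₁ = !![1, 0; 1, 1]) (hR₁ : R₁ = !![1, 1; 0, 1])
    (hL₂ : L₂ = !![0, 0; 1, 1]) (hR₂ : R₂ = !![1, 1; 0, 0])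
    (l : List (Matrix (Fin 2) (Fin 2) ℕ))
    (hmem : ∀ M ∈ l, M ∈ ({L₁, R₁, L₂, R₂} : Set (Matrix (Fin 2) (Fin 2) ℕ)))
    (hblock : ∃ l₁ l₂ : List (Matrix (Fin 2) (Fin 2) ℕ),
      l = l₁ ++ [R₁, L₁, R₁, L₁] ++ l₂) :
    ∀ j : Fin 2, 2 ≤ Matrix.vecMul ![1, 1] l.prod j := by
  have hcol : ∀ M ∈ l, ∀ j, ∃ i, 1 ≤ M i j := by
    intro M hM j
    rcases hmem M hM with rfl | rfl | rfl | rfl <;> subst_vars <;> fin_cases j <;>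
      simp [Fin.exists_fin_two]
  obtain ⟨l₁, l₂, rfl⟩ := hblock
  simp only [List.forall_mem_append] at hcol
  obtain ⟨⟨hcol₁, -⟩, hcol₂⟩ := hcol
  have hprefix : ∀ j, 1 ≤ Matrix.vecMul ![1, 1] l₁.prod j :=
    Matrix.le_vecMul_list_prod hcol₁ (by simp [Fin.forall_fin_two])
  rw [List.prod_append, List.prod_append, ← Matrix.vecMul_vecMul, ← Matrix.vecMul_vecMul]
  refine Matrix.le_vecMul_list_prod hcol₂ ?_
  generalize Matrix.vecMul ![1, 1] l₁.prod = v at hprefix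
  rw [Fin.forall_fin_two] at hprefix ⊢
  subst hL₁ hR₁
  simp [Matrix.vecMul, dotProduct, Fin.sum_univ_two]
  omega
end
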